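/- Let H be a connected r-uniform hypergraph on n vertices (r ≥ 3), with signless Laplacian tensor Q(H) = D(H) + A(H), where D(H) is the diagonal degree tensor. Then ρ(Q(H)) ≥ 2((1/n) ∑_{i=1}^n d_i^{r/(r-1)})^{(r-1)/r}, with equality if and only if H is regular. -/

import Mathlib

/-- Degree of a vertex in a hypergraph: the number of edges containing it. -/
def hDeg {V : Type*} [DecidableEq V] (E : Finset (Finset V)) (i : V) : ℕ :=
  (E.filter (fun e => i ∈ e)).card

/-- Adjacency tensor of an `r`-uniform hypergraph: entry `1/(r-1)!` on index tuples
whose underlying set is an edge, and `0` otherwise. -/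
noncomputable def adjT {V : Type*} [DecidableEq V] (r : ℕ) (E : Finset (Finset V)) :
    (Fin r → V) → ℝ :=
  fun t => if Finset.image t Finset.univ ∈ E then 1 / ((r - 1).factorial : ℝ) else 0

/-- The quadratic-type form `x^T (T x) = ∑ t, T_t ∏ₖ x_{tₖ}` of an order-`r` tensor. -/
noncomputable def form {V : Type*} [Fintype V] {r : ℕ} (T : (Fin r → V) → ℝ) (x : V → ℝ) : ℝ :=
  ∑ t : Fin r → V, T t * ∏ k, x (t k)

/-- Spectral radius of a nonnegative symmetric order-`r` tensor, via the variational
characterization: the supremum of `x^T (T x)` over nonnegative `x` with `∑ xᵢ^r = 1`. -/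
noncomputable def specRad {V : Type*} [Fintype V] {r : ℕ}
    (T : (Fin r → V) → ℝ) : ℝ :=
  sSup {q : ℝ | ∃ x : V → ℝ, (∀ i, 0 ≤ x i) ∧ (∑ i, x i ^ r = 1) ∧ q = form T x}

/-- Two vertices are adjacent in a hypergraph if some edge contains both. -/
def hAdj {V : Type*} (E : Finset (Finset V)) (i j : V) : Prop :=
  ∃ e ∈ E, i ∈ e ∧ j ∈ e

/-- A hypergraph is connected if any two vertices are joined by a walk. -/
def hConn {V : Type*} (E : Finset (Finset V)) : Prop :=
  ∀ i j : V, Relation.ReflTransGen (hAdj E) i j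

/-- The order-`r` diagonal tensor with diagonal entries `d i`. -/
def diagT {V : Type*} [Fintype V] [DecidableEq V] {r : ℕ} (d : V → ℝ) :
    (Fin r → V) → ℝ :=
  fun t => ∑ i, if ∀ k, t k = i then d i else 0

open Finset

theorem mul_prod_le_sum_pow {V : Type*} {r : ℕ} (hr : 0 < r) {e : Finset V} (he : e.card = r)
    {z : V → ℝ} (hz : ∀ i, 0 ≤ z i) : r * ∏ i ∈ e, z i ≤ ∑ i ∈ e, z i ^ r := by
  have hr' : (0 : ℝ) < r := by exact_mod_cast hr
  have h := Real.geom_mean_le_arith_mean_weighted e (fun _ => (1 : ℝ) / r) (fun i => z i ^ r)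
    (fun _ _ => by positivity) (by simp [he, hr'.ne']) (fun i _ => pow_nonneg (hz i) r)
  have h1 : ∏ i ∈ e, (z i ^ r) ^ ((1 : ℝ) / r) = ∏ i ∈ e, z i :=
    prod_congr rfl fun i _ => by
      rw [one_div, Real.pow_rpow_inv_natCast (hz i) hr.ne']
  rw [h1, ← mul_sum] at h
  field_simp at h
  linarith

theorem sum_hDeg_mul {V : Type*} [Fintype V] [DecidableEq V] (E : Finset (Finset V)) (f : V → ℝ) :
    ∑ i, (hDeg E i : ℝ) * f i = ∑ e ∈ E, ∑ i ∈ e, f i := by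
  simp_rw [hDeg, card_filter, Nat.cast_sum, sum_mul]
  rw [sum_comm]
  refine sum_congr rfl fun e _ => ?_
  simp

theorem form_diagT {V : Type*} [Fintype V] [DecidableEq V] {r : ℕ} (d x : V → ℝ) :
    form (diagT d : (Fin r → V) → ℝ) x = ∑ i, d i * x i ^ r := by
  simp_rw [form, diagT, sum_mul]
  rw [sum_comm]
  refine sum_congr rfl fun i _ => ?_
  rw [sum_eq_single (fun _ => i)]
  · simp
  · intro t _ ht
    rw [if_neg (fun h => ht (funext h)), zero_mul]
  · simp

theorem card_image_univ_eq {V : Type*} [Fintype V] [DecidableEq V] {r : ℕ} {e : Finset V}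
    (he : e.card = r) :
    (univ.filter fun t : Fin r → V => univ.image t = e).card = r.factorial := by
  have h : Fintype.card (Fin r ≃ e) = r.factorial := by
    rw [Fintype.card_equiv (Fintype.equivOfCardEq (by simp [he]))]; simp
  rw [← h, ← Finset.card_univ]
  symm
  refine Finset.card_bij (fun g _ k => (g k : V)) ?_ ?_ ?_
  · intro g _
    simp only [mem_filter, mem_univ, true_and]
    ext v
    simp only [mem_image, mem_univ, true_and]
    constructor
    · rintro ⟨k, rfl⟩; exact (g k).2
    · intro hv; exact ⟨g.symm ⟨v, hv⟩, by simp⟩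
  · intro g _ g' _ hgg
    ext k
    exact congrFun hgg k
  · intro t ht
    simp only [mem_filter, mem_univ, true_and] at ht
    have hm : ∀ k, t k ∈ e := fun k => ht ▸ mem_image_of_mem t (mem_univ k)
    have hs : Function.Surjective (fun k => (⟨t k, hm k⟩ : e)) := by
      rintro ⟨v, hv⟩
      rw [← ht] at hv
      obtain ⟨k, -, rfl⟩ := mem_image.1 hv
      exact ⟨k, rfl⟩
    exact ⟨Equiv.ofBijective _ ((Fintype.bijective_iff_surjective_and_card _).2 ⟨hs, by simp [he]⟩),
      mem_univ _, rfl⟩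

theorem form_adjT {V : Type*} [Fintype V] [DecidableEq V] {r : ℕ} (hr : 0 < r)
    {E : Finset (Finset V)} (hE : ∀ e ∈ E, e.card = r) (x : V → ℝ) :
    form (adjT r E) x = r * ∑ e ∈ E, ∏ i ∈ e, x i := by
  simp_rw [form, adjT, ite_mul, zero_mul]
  rw [← sum_filter, ← sum_fiberwise_of_maps_to (t := E) (g := fun t => univ.image t)
    (fun t ht => (mem_filter.1 ht).2), mul_sum]
  refine sum_congr rfl fun e he => ?_
  have h1 : ∀ t ∈ (univ.filter fun t : Fin r → V => univ.image t ∈ E).filter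
      (fun t => univ.image t = e), 1 / ((r - 1).factorial : ℝ) * ∏ k, x (t k) =
        1 / ((r - 1).factorial : ℝ) * ∏ i ∈ e, x i := by
    intro t ht
    have ht' := (mem_filter.1 ht).2
    have hinj : Set.InjOn t (univ : Finset (Fin r)) :=
      card_image_iff.1 (by rw [ht', hE e he]; simp)
    rw [← ht', prod_image hinj]
  have h2 : (univ.filter fun t : Fin r → V => univ.image t ∈ E).filter
      (fun t => univ.image t = e) = univ.filter fun t : Fin r → V => univ.image t = e := by
    ext t
    simp only [mem_filter, mem_univ, true_and, and_iff_right_iff_imp]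
    rintro rfl; exact he
  rw [sum_congr rfl h1, h2, sum_const, card_image_univ_eq (hE e he), nsmul_eq_mul,
    ← Nat.mul_factorial_pred hr.ne', Nat.cast_mul]
  have : ((r - 1).factorial : ℝ) ≠ 0 := by positivity
  field_simp

/-- The form of the signless Laplacian tensor, written over vertices and edges. -/
noncomputable def signlessForm {V : Type*} [Fintype V] [DecidableEq V] (r : ℕ)
    (E : Finset (Finset V)) (x : V → ℝ) : ℝ :=
  ∑ i, (hDeg E i : ℝ) * x i ^ r + r * ∑ e ∈ E, ∏ i ∈ e, x i

theorem form_signless {V : Type*} [Fintype V] [DecidableEq V] {r : ℕ} (hr : 0 < r)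
    {E : Finset (Finset V)} (hE : ∀ e ∈ E, e.card = r) (x : V → ℝ) :
    form (fun t : Fin r → V => diagT (fun i => (hDeg E i : ℝ)) t + adjT r E t) x =
      signlessForm r E x := by
  rw [signlessForm, ← form_adjT hr hE, ← form_diagT]
  simp [form, add_mul, sum_add_distrib]

theorem signlessForm_smul {V : Type*} [Fintype V] [DecidableEq V] {r : ℕ}
    {E : Finset (Finset V)} (hE : ∀ e ∈ E, e.card = r) (c : ℝ) (x : V → ℝ) :
    signlessForm r E (fun i => c * x i) = c ^ r * signlessForm r E x := by
  simp only [signlessForm, mul_pow, prod_mul_distrib, prod_const]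
  have h : ∑ e ∈ E, c ^ e.card * ∏ i ∈ e, x i = c ^ r * ∑ e ∈ E, ∏ i ∈ e, x i := by
    rw [mul_sum]
    exact sum_congr rfl fun e he => by rw [hE e he]
  rw [h, mul_add, mul_sum]
  congr 1
  · rw [mul_sum]
    exact sum_congr rfl fun i _ => by ring
  · rw [← mul_sum]
    ring

theorem signlessForm_le_of_hDeg_eq {V : Type*} [Fintype V] [DecidableEq V] {r : ℕ} (hr : 0 < r)
    {E : Finset (Finset V)} (hE : ∀ e ∈ E, e.card = r) {d : ℕ} (hd : ∀ i, hDeg E i = d)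
    {x : V → ℝ} (hx : ∀ i, 0 ≤ x i) : signlessForm r E x ≤ 2 * d * ∑ i, x i ^ r := by
  have h : r * ∑ e ∈ E, ∏ i ∈ e, x i ≤ ∑ i, (hDeg E i : ℝ) * x i ^ r := by
    rw [sum_hDeg_mul, mul_sum]
    exact sum_le_sum fun e he => mul_prod_le_sum_pow hr (hE e he) hx
  have h2 : ∑ i, (hDeg E i : ℝ) * x i ^ r = d * ∑ i, x i ^ r := by
    simp_rw [hd, mul_sum]
  rw [signlessForm]
  linarith

/-- A nonnegative maximizer of the form, whose value dominates the form homogeneously. -/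
theorem exists_maximizer {V : Type*} [Fintype V] [Nonempty V] [DecidableEq V] {r : ℕ}
    (hr : 0 < r) {E : Finset (Finset V)} (hE : ∀ e ∈ E, e.card = r) :
    ∃ x : V → ℝ, (∀ i, 0 ≤ x i) ∧ ∑ i, x i ^ r = 1 ∧
      specRad (fun t : Fin r → V => diagT (fun i => (hDeg E i : ℝ)) t + adjT r E t) =
        signlessForm r E x ∧
      ∀ z : V → ℝ, (∀ i, 0 ≤ z i) → signlessForm r E z ≤ signlessForm r E x * ∑ i, z i ^ r := by
  set K : Set (V → ℝ) := {x | (∀ i, 0 ≤ x i) ∧ ∑ i, x i ^ r = 1} with hK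
  have hsub : K ⊆ Set.Icc 0 1 := by
    rintro x ⟨h0, h1⟩
    refine ⟨h0, fun i => ?_⟩
    have : x i ^ r ≤ 1 := h1 ▸ single_le_sum (fun j _ => pow_nonneg (h0 j) r) (mem_univ i)
    exact (pow_le_one_iff_of_nonneg (h0 i) hr.ne').1 this
  have hcl : IsClosed K := by
    refine IsClosed.inter ?_ ?_
    · exact (isClosed_Ici : IsClosed (Set.Ici (0 : V → ℝ)))
    · exact isClosed_eq (by fun_prop) continuous_const
  have hcomp : IsCompact K := isCompact_Icc.of_isClosed_subset hcl hsub
  have hne : K.Nonempty := by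
    obtain ⟨v⟩ := ‹Nonempty V›
    refine ⟨Pi.single v 1, fun i => ?_, ?_⟩
    · by_cases h : i = v
      · subst h; simp
      · simp [h]
    · rw [sum_eq_single v (fun j _ hj => by simp [hj, hr.ne']) (by simp)]; simp
  have hcont : Continuous (signlessForm r E) := by unfold signlessForm; fun_prop
  obtain ⟨x, hxK, hmax⟩ := hcomp.exists_isMaxOn hne hcont.continuousOn
  refine ⟨x, hxK.1, hxK.2, ?_, ?_⟩
  · refine IsGreatest.csSup_eq ⟨⟨x, hxK.1, hxK.2, (form_signless hr hE x).symm⟩, ?_⟩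
    rintro q ⟨z, hz0, hz1, rfl⟩
    rw [form_signless hr hE]
    exact hmax ⟨hz0, hz1⟩
  · intro z hz
    have hs0 : 0 ≤ ∑ i, z i ^ r := sum_nonneg fun i _ => pow_nonneg (hz i) r
    rcases hs0.eq_or_lt with h | h
    · have hz0 : z = fun i => 0 * z i := by
        funext i
        have := (sum_eq_zero_iff_of_nonneg fun i _ => pow_nonneg (hz i) r).1 h.symm i (mem_univ i)
        simpa using eq_zero_of_pow_eq_zero this
      rw [← h, hz0, signlessForm_smul hE, zero_pow hr.ne']
      simp
    · set s := ∑ i, z i ^ r with hs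
      set c := s ^ ((1 : ℝ) / r) with hc
      have hcr : c ^ r = s := by
        rw [hc, one_div, Real.rpow_inv_natCast_pow h.le hr.ne']
      have hcpos : 0 < c := Real.rpow_pos_of_pos h _
      have hw : (fun i => c⁻¹ * z i) ∈ K := by
        refine ⟨fun i => mul_nonneg (by positivity) (hz i), ?_⟩
        simp_rw [mul_pow, ← mul_sum, inv_pow, hcr]
        exact inv_mul_cancel₀ h.ne'
      have := hmax hw
      simp only [Set.mem_ofPred_eq] at this
      rw [signlessForm_smul hE, inv_pow, hcr, inv_mul_le_iff₀ h] at this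
      linarith

theorem exists_edge_crossing {V : Type*} {E : Finset (Finset V)} (hc : hConn E) {P : V → Prop}
    {a b : V} (ha : P a) (hb : ¬ P b) : ∃ e ∈ E, (∃ i ∈ e, P i) ∧ ∃ j ∈ e, ¬ P j := by
  by_contra! h
  refine hb ?_
  clear hb
  induction hc a b with
  | refl => exact ha
  | tail _ hstep ih =>
    obtain ⟨e, he, hi, hj⟩ := hstep
    exact h e he ⟨_, hi, ih⟩ _ hj

theorem maximizer_pos {V : Type*} [Fintype V] [DecidableEq V] {r : ℕ} (hr : 0 < r)
    {E : Finset (Finset V)} (hE : ∀ e ∈ E, e.card = r) (hc : hConn E) {ρ : ℝ} {x : V → ℝ}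
    (hx : ∀ i, 0 ≤ x i) (hx1 : ∑ i, x i ^ r = 1) (hρ : signlessForm r E x = ρ)
    (hmax : ∀ z : V → ℝ, (∀ i, 0 ≤ z i) → signlessForm r E z ≤ ρ * ∑ i, z i ^ r) (i : V) :
    0 < x i := by
  by_contra hi
  have hi0 : x i = 0 := le_antisymm (not_lt.1 hi) (hx i)
  obtain ⟨j, hj⟩ : ∃ j, x j ≠ 0 := by
    by_contra! h
    simp [h, hr.ne'] at hx1
  obtain ⟨e₀, he₀, ⟨a, ha, ha0⟩, b, hb, hb0⟩ :=
    exists_edge_crossing hc (P := fun v => x v = 0) hi0 hj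
  have hρ0 : 0 ≤ ρ := by
    rw [← hρ, signlessForm]
    have h1 : ∀ e ∈ E, 0 ≤ ∏ i ∈ e, x i := fun e _ => prod_nonneg fun i _ => hx i
    have h2 : ∀ i ∈ univ, 0 ≤ (hDeg E i : ℝ) * x i ^ r := fun i _ =>
      mul_nonneg (Nat.cast_nonneg _) (pow_nonneg (hx i) r)
    exact add_nonneg (sum_nonneg h2) (mul_nonneg (Nat.cast_nonneg _) (sum_nonneg h1))
  set c : ℝ := ∏ v ∈ e₀, if x v = 0 then 1 else x v with hcdef
  have hcpos : 0 < c := prod_pos fun v _ => by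
    split_ifs with h
    · exact one_pos
    · exact (hx v).lt_of_ne' h
  set N : ℝ := (Fintype.card V : ℝ) with hN
  have hN0 : 0 ≤ N := Nat.cast_nonneg _
  set s : ℝ := c / (c + ρ * N) with hs
  have hden : 0 < c + ρ * N := by positivity
  have hspos : 0 < s := by positivity
  have hs1 : s ≤ 1 := (div_le_one hden).2 (by linarith [mul_nonneg hρ0 hN0])
  set z : V → ℝ := fun v => if x v = 0 then s else x v with hz
  have hz0 : ∀ v, 0 ≤ z v := fun v => by
    simp only [hz]; split_ifs
    · exact hspos.le
    · exact hx v
  have hxz : ∀ v, x v ≤ z v := fun v => by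
    simp only [hz]; split_ifs with h
    · rw [h]; exact hspos.le
    · exact le_rfl
  have hsum : ∑ v, z v ^ r ≤ 1 + N * s ^ r := by
    calc ∑ v, z v ^ r ≤ ∑ v, (x v ^ r + s ^ r) := sum_le_sum fun v _ => by
          simp only [hz]; split_ifs with h
          · rw [h, zero_pow hr.ne', zero_add]
          · linarith [pow_pos hspos r]
      _ = 1 + N * s ^ r := by rw [sum_add_distrib, hx1]; simp [hN]
  have hprod : s ^ (r - 1) * c ≤ ∏ v ∈ e₀, z v := by
    have h1 : ∏ v ∈ e₀, z v =
        (∏ v ∈ e₀, if x v = 0 then s else 1) * c := by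
      rw [hcdef, ← prod_mul_distrib]
      exact prod_congr rfl fun v _ => by simp only [hz]; split_ifs <;> simp
    rw [h1]
    refine mul_le_mul_of_nonneg_right ?_ hcpos.le
    rw [prod_ite, prod_const, prod_const_one, mul_one]
    refine pow_le_pow_of_le_one hspos.le hs1 ?_
    have : (e₀.filter fun v => x v = 0).card < e₀.card :=
      card_lt_card (filter_ssubset.2 ⟨b, hb, hb0⟩)
    have := hE e₀ he₀
    omega
  have hgain : signlessForm r E x + r * (s ^ (r - 1) * c) ≤ signlessForm r E z := by
    have h1 : ∑ v, (hDeg E v : ℝ) * x v ^ r ≤ ∑ v, (hDeg E v : ℝ) * z v ^ r :=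
      sum_le_sum fun v _ => mul_le_mul_of_nonneg_left (pow_le_pow_left₀ (hx v) (hxz v) r)
        (Nat.cast_nonneg _)
    have h2 : ∑ e ∈ E, ∏ v ∈ e, x v + s ^ (r - 1) * c ≤ ∑ e ∈ E, ∏ v ∈ e, z v := by
      rw [← add_sum_erase _ _ he₀, ← add_sum_erase _ (fun e => ∏ v ∈ e, z v) he₀,
        prod_eq_zero ha ha0]
      have : ∑ e ∈ E.erase e₀, ∏ v ∈ e, x v ≤ ∑ e ∈ E.erase e₀, ∏ v ∈ e, z v :=
        sum_le_sum fun e _ => prod_le_prod (fun v _ => hx v) fun v _ => hxz v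
      linarith
    have h3 := mul_le_mul_of_nonneg_left h2 (Nat.cast_nonneg (α := ℝ) r)
    simp only [signlessForm]
    linarith
  have hfin : r * (s ^ (r - 1) * c) ≤ ρ * (N * s ^ r) := by
    have := (hmax z hz0).trans (mul_le_mul_of_nonneg_left hsum hρ0)
    linarith
  have hpow : s ^ r = s ^ (r - 1) * s := by rw [← pow_succ, Nat.sub_add_cancel hr]
  have hsp : 0 < s ^ (r - 1) := pow_pos hspos _
  have h4 : r * c ≤ ρ * N * s := by
    rw [hpow] at hfin
    refine le_of_mul_le_mul_left ?_ hsp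
    linarith
  have h5 : ρ * N * s < c := by
    rw [hs, ← mul_div_assoc, div_lt_iff₀ hden]
    nlinarith [mul_pos hcpos hcpos]
  have h6 : (1 : ℝ) ≤ r := by exact_mod_cast hr
  nlinarith

theorem maximizer_eigen {V : Type*} [Fintype V] [DecidableEq V] {r : ℕ} (hr : 0 < r)
    {E : Finset (Finset V)} {ρ : ℝ} {x : V → ℝ}
    (hx : ∀ i, 0 ≤ x i) (hx1 : ∑ i, x i ^ r = 1) (hρ : signlessForm r E x = ρ)
    (hmax : ∀ z : V → ℝ, (∀ i, 0 ≤ z i) → signlessForm r E z ≤ ρ * ∑ i, z i ^ r) (j : V) :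
    ∑ e ∈ E with j ∈ e, ∏ i ∈ e, x i = (ρ - hDeg E j) * x j ^ r := by
  set b := ∑ e ∈ E with j ∈ e, ∏ i ∈ e, x i with hb
  have hr' : (0 : ℝ) < r := by exact_mod_cast hr
  have key : ∀ u : ℝ, 0 ≤ u → 0 ≤ (ρ - hDeg E j) * x j ^ r * (u ^ r - 1) - r * (u - 1) * b := by
    intro u hu
    set z : V → ℝ := fun v => (if v = j then u else 1) * x v with hz
    have hz0 : ∀ v, 0 ≤ z v := fun v => mul_nonneg (by split_ifs <;> simp [hu]) (hx v)
    have hsum : ∀ w : V → ℝ, ∑ v, w v * z v ^ r =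
        ∑ v, w v * x v ^ r + w j * x j ^ r * (u ^ r - 1) := by
      intro w
      rw [← sub_eq_iff_eq_add', ← sum_sub_distrib, sum_eq_single j]
      · simp only [hz, if_true]; ring
      · intro v _ hv
        simp [hz, hv]
      · simp
    have hprod : ∑ e ∈ E, ∏ v ∈ e, z v = ∑ e ∈ E, ∏ v ∈ e, x v + (u - 1) * b := by
      rw [← sub_eq_iff_eq_add', ← sum_sub_distrib, hb, mul_sum, sum_filter]
      refine sum_congr rfl fun e _ => ?_
      simp only [hz, prod_mul_distrib, prod_ite_eq']
      split_ifs <;> ring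
    have h1 := hmax z hz0
    have h2 := hsum (fun _ => 1)
    simp only [one_mul, hx1] at h2
    rw [signlessForm, hsum, hprod, h2, ← hρ, signlessForm] at h1
    rw [← hρ, signlessForm]
    linarith
  have hmin : IsLocalMin
      (fun u : ℝ => (ρ - hDeg E j) * x j ^ r * (u ^ r - 1) - r * (u - 1) * b) 1 := by
    filter_upwards [lt_mem_nhds (zero_lt_one : (0 : ℝ) < 1)] with u hu
    simpa using key u hu.le
  have hder : HasDerivAt
      (fun u : ℝ => (ρ - hDeg E j) * x j ^ r * (u ^ r - 1) - r * (u - 1) * b)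
      ((ρ - hDeg E j) * x j ^ r * (r * 1 ^ (r - 1)) - r * 1 * b) 1 :=
    (((hasDerivAt_pow r (1 : ℝ)).sub_const 1).const_mul _).sub
      ((((hasDerivAt_id (1 : ℝ)).sub_const 1).const_mul (r : ℝ)).mul_const b)
  have h := hmin.hasDerivAt_eq_zero hder
  simp only [one_pow, mul_one] at h
  refine mul_left_cancel₀ hr'.ne' ?_
  linarith

theorem mul_le_pow_add {r : ℕ} {y : ℝ} (hy : 0 ≤ y) : r * y ≤ y ^ r + r - 1 := by
  have := one_add_mul_le_pow (a := y - 1) (by linarith) r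
  simp only [add_sub_cancel] at this
  linarith

theorem mul_lt_pow_add {r : ℕ} (hr : 1 < r) {y : ℝ} (hy : 0 ≤ y) (hy1 : y ≠ 1) :
    r * y < y ^ r + r - 1 := by
  have := one_add_mul_self_lt_rpow_one_add (s := y - 1) (by linarith) (sub_ne_zero.2 hy1)
    (p := r) (by exact_mod_cast hr)
  simp only [add_sub_cancel, Real.rpow_natCast] at this
  linarith

/-- Hölder-type estimate of an edge against a positive vector. -/
theorem edge_sum_le {V : Type*} [DecidableEq V] {r : ℕ} (hr : 0 < r) {e : Finset V}
    (he : e.card = r) {x y : V → ℝ} (hx : ∀ i, 0 < x i) (hy : ∀ i, 0 ≤ y i) :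
    r * ∑ i ∈ e, y i ≤ ∑ j ∈ e, (y j ^ r + r - 1) / x j ^ r * ∏ i ∈ e, x i := by
  have hP : 0 < ∏ i ∈ e, x i := prod_pos fun i _ => hx i
  have h1 : ∀ i ∈ e, r * y i ≤
      (∑ j ∈ e, 1 / x j ^ r + (y i ^ r - 1) / x i ^ r) * ∏ i ∈ e, x i := by
    intro i hi
    have h := mul_prod_le_sum_pow hr he (z := fun j => (if j = i then y i else 1) / x j)
      fun j => div_nonneg (by split_ifs <;> simp [hy]) (hx j).le
    have h2 : ∑ j ∈ e, ((if j = i then y i else 1) / x j) ^ r =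
        ∑ j ∈ e, 1 / x j ^ r + (y i ^ r - 1) / x i ^ r := by
      rw [← sub_eq_iff_eq_add', ← sum_sub_distrib, sum_eq_single_of_mem i hi]
      · simp only [if_true, div_pow]; ring
      · intro j _ hj
        simp [hj]
    rw [h2, prod_div_distrib, prod_ite_eq' e i, if_pos hi, ← mul_div_assoc, div_le_iff₀ hP] at h
    exact h
  have h3 := sum_le_sum h1
  rw [← mul_sum, ← sum_mul, sum_add_distrib, sum_const, he, nsmul_eq_mul,
    mul_sum e (fun j => 1 / x j ^ r), ← sum_add_distrib] at h3
  rw [← sum_mul]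
  refine h3.trans_eq ?_
  congr 1
  exact sum_congr rfl fun j _ => by ring

theorem mul_sum_hDeg_le {V : Type*} [Fintype V] [DecidableEq V] {r : ℕ} (hr : 0 < r)
    {E : Finset (Finset V)} (hE : ∀ e ∈ E, e.card = r) {ρ : ℝ} {x : V → ℝ}
    (hx : ∀ i, 0 < x i)
    (heig : ∀ j, ∑ e ∈ E with j ∈ e, ∏ i ∈ e, x i = (ρ - hDeg E j) * x j ^ r)
    {y : V → ℝ} (hy : ∀ i, 0 ≤ y i) :
    r * ∑ i, (hDeg E i : ℝ) * y i ≤ ∑ j, (ρ - hDeg E j) * (y j ^ r + r - 1) := by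
  rw [sum_hDeg_mul, mul_sum]
  refine (sum_le_sum fun e he => edge_sum_le hr (hE e he) hx hy).trans_eq ?_
  have h : ∀ j, (ρ - hDeg E j) * (y j ^ r + r - 1) =
      ∑ e ∈ E, if j ∈ e then (y j ^ r + r - 1) / x j ^ r * ∏ i ∈ e, x i else 0 := by
    intro j
    rw [← sum_filter, ← mul_sum, heig]
    have := (pow_pos (hx j) r).ne'
    field_simp
  simp_rw [h]
  rw [sum_comm]
  exact sum_congr rfl fun e _ => by simp

theorem hDeg_pos_of_not_regular {V : Type*} [DecidableEq V] {E : Finset (Finset V)}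
    (hc : hConn E) (hreg : ¬ ∃ d : ℕ, ∀ i, hDeg E i = d) (j : V) : 0 < hDeg E j := by
  obtain ⟨i, hi⟩ : ∃ i, hDeg E i ≠ hDeg E j := by
    by_contra! h
    exact hreg ⟨_, h⟩
  rcases (hc j i).cases_head with h | ⟨k, ⟨e, he, hj, -⟩, -⟩
  · exact absurd (by rw [h]) hi
  · exact card_pos.2 ⟨e, mem_filter.2 ⟨he, hj⟩⟩

theorem powerMean_lt_of_not_regular {V : Type*} [Fintype V] [DecidableEq V] {r : ℕ} (hr : 1 < r)
    {E : Finset (Finset V)} (hE : ∀ e ∈ E, e.card = r) (hc : hConn E)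
    (hreg : ¬ ∃ d : ℕ, ∀ i, hDeg E i = d) {ρ : ℝ} {x : V → ℝ} (hx : ∀ i, 0 < x i)
    (heig : ∀ j, ∑ e ∈ E with j ∈ e, ∏ i ∈ e, x i = (ρ - hDeg E j) * x j ^ r) :
    2 * ((1 / (Fintype.card V : ℝ)) * ∑ i, (hDeg E i : ℝ) ^ ((r : ℝ) / ((r : ℝ) - 1)))
      ^ (((r : ℝ) - 1) / (r : ℝ)) < ρ := by
  have hr1 : (1 : ℝ) < r := by exact_mod_cast hr
  have hr0 : (0 : ℝ) < r := by linarith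
  have hr1' : (r : ℝ) - 1 ≠ 0 := by linarith
  have hd : ∀ j, (0 : ℝ) < hDeg E j := fun j => by
    exact_mod_cast hDeg_pos_of_not_regular hc hreg j
  have hne : Nonempty V := by
    by_contra h
    exact hreg ⟨0, fun i => absurd ⟨i⟩ h⟩
  set N : ℝ := (Fintype.card V : ℝ) with hN
  have hNpos : 0 < N := Nat.cast_pos.2 Fintype.card_pos
  set p : ℝ := (r : ℝ) / ((r : ℝ) - 1) with hp
  set S : ℝ := ∑ i, (hDeg E i : ℝ) ^ p with hS
  have hSpos : 0 < S := sum_pos (fun i _ => Real.rpow_pos_of_pos (hd i) p) univ_nonempty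
  set q : ℝ := 1 / N * S with hq
  have hqpos : 0 < q := by positivity
  set c : ℝ := q ^ (-(1 / (r : ℝ))) with hcdef
  have hcpos : 0 < c := Real.rpow_pos_of_pos hqpos _
  have hcr : c ^ r = q⁻¹ := by
    rw [hcdef, ← Real.rpow_natCast, ← Real.rpow_mul hqpos.le, ← Real.rpow_neg_one]
    congr 1
    field_simp
  have hqc : q ^ (((r : ℝ) - 1) / r) = c * q := by
    rw [hcdef, ← Real.rpow_add_one hqpos.ne']
    congr 1
    field_simp
    ring
  set y : V → ℝ := fun j => c * (hDeg E j : ℝ) ^ (1 / ((r : ℝ) - 1)) with hy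
  have hy0 : ∀ j, 0 ≤ y j := fun j => (mul_pos hcpos (Real.rpow_pos_of_pos (hd j) _)).le
  have hyr : ∀ j, y j ^ r = c ^ r * (hDeg E j : ℝ) ^ p := fun j => by
    rw [hy, mul_pow, ← Real.rpow_natCast ((hDeg E j : ℝ) ^ _), ← Real.rpow_mul (hd j).le]
    congr 2
    rw [hp]
    ring
  have hdy : ∀ j, (hDeg E j : ℝ) * y j = c * (hDeg E j : ℝ) ^ p := fun j => by
    have : p = 1 / ((r : ℝ) - 1) + 1 := by
      rw [hp]
      field_simp
      ring
    rw [this, Real.rpow_add_one (hd j).ne', hy]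
    ring
  obtain ⟨j₀, hj₀⟩ : ∃ j, y j ≠ 1 := by
    by_contra! h
    obtain ⟨i₀⟩ := hne
    refine hreg ⟨hDeg E i₀, fun i => ?_⟩
    have h1 : (hDeg E i : ℝ) ^ (1 / ((r : ℝ) - 1)) = (hDeg E i₀ : ℝ) ^ (1 / ((r : ℝ) - 1)) :=
      mul_left_cancel₀ hcpos.ne' ((h i).trans (h i₀).symm)
    exact_mod_cast (Real.rpow_left_inj (hd i).le (hd i₀).le (one_div_ne_zero hr1')).1 h1
  have h1 := mul_sum_hDeg_le (by omega) hE hx heig hy0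
  have h2 : r * ∑ i, (hDeg E i : ℝ) * y i < ∑ j, (hDeg E j : ℝ) * (y j ^ r + r - 1) := by
    rw [mul_sum]
    refine sum_lt_sum (fun i _ => ?_) ⟨j₀, mem_univ _, ?_⟩
    · rw [mul_left_comm]
      exact mul_le_mul_of_nonneg_left (mul_le_pow_add (hy0 i)) (hd i).le
    · rw [mul_left_comm]
      exact mul_lt_mul_of_pos_left (mul_lt_pow_add hr (hy0 j₀) hj₀) (hd j₀)
  have h3 : ∑ j, (ρ - hDeg E j) * (y j ^ r + r - 1) +
      ∑ j, (hDeg E j : ℝ) * (y j ^ r + r - 1) = ρ * (r * N) := by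
    have h4 : ∑ j, y j ^ r = N := by
      simp_rw [hyr, ← mul_sum, ← hS, hcr, hq]
      field_simp
    rw [← sum_add_distrib]
    simp_rw [← add_mul, sub_add_cancel, ← mul_sum, sum_sub_distrib, sum_add_distrib, h4]
    simp only [sum_const, card_univ, nsmul_eq_mul, ← hN]
    ring
  have h5 : ∑ i, (hDeg E i : ℝ) * y i = c * (q * N) := by
    simp_rw [hdy, ← mul_sum, ← hS, hq]
    field_simp
  rw [h5] at h1 h2
  rw [hqc]
  refine lt_of_mul_lt_mul_right ?_ (mul_pos hr0 hNpos).le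
  linarith

theorem powerMean_const {V : Type*} [Fintype V] [Nonempty V] {r : ℕ} (hr : 1 < r) (d : ℕ) :
    ((1 / (Fintype.card V : ℝ)) * ∑ _i : V, (d : ℝ) ^ ((r : ℝ) / ((r : ℝ) - 1)))
      ^ (((r : ℝ) - 1) / (r : ℝ)) = d := by
  have hr1 : (1 : ℝ) < r := by exact_mod_cast hr
  have hr1' : (r : ℝ) - 1 ≠ 0 := by linarith
  have hN : (Fintype.card V : ℝ) ≠ 0 := by exact_mod_cast Fintype.card_ne_zero
  rw [sum_const, card_univ, nsmul_eq_mul, ← mul_assoc, one_div_mul_cancel hN, one_mul,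
    ← Real.rpow_mul (Nat.cast_nonneg d)]
  rw [show (r : ℝ) / ((r : ℝ) - 1) * (((r : ℝ) - 1) / r) = 1 by field_simp, Real.rpow_one]

theorem le_of_hDeg_eq {V : Type*} [Fintype V] [Nonempty V] [DecidableEq V] {r : ℕ}
    {E : Finset (Finset V)} (hE : ∀ e ∈ E, e.card = r) {d : ℕ} (hd : ∀ i, hDeg E i = d) {ρ : ℝ}
    (hmax : ∀ z : V → ℝ, (∀ i, 0 ≤ z i) → signlessForm r E z ≤ ρ * ∑ i, z i ^ r) :
    2 * d ≤ ρ := by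
  have h := hmax (fun _ => 1) fun _ => zero_le_one
  have h1 := (sum_hDeg_mul E (fun _ => 1)).trans
    (sum_congr rfl fun e he => by rw [sum_const, hE e he])
  have hN : (0 : ℝ) < Fintype.card V := by exact_mod_cast Fintype.card_pos
  simp only [signlessForm, hd, one_pow, mul_one, prod_const_one, sum_const, card_univ,
    nsmul_eq_mul] at h h1
  refine le_of_mul_le_mul_right ?_ hN
  linarith

theorem stmt_17 (n r : ℕ) (hn : 0 < n) (hr : 3 ≤ r)
    (E : Finset (Finset (Fin n))) (hE : ∀ e ∈ E, e.card = r) (hc : hConn E) :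
    2 * ((1 / (n : ℝ)) * ∑ i, (hDeg E i : ℝ) ^ ((r : ℝ) / ((r : ℝ) - 1)))
          ^ (((r : ℝ) - 1) / (r : ℝ)) ≤
        specRad (fun t : Fin r → Fin n =>
          diagT (fun i => (hDeg E i : ℝ)) t + adjT r E t) ∧
      (specRad (fun t : Fin r → Fin n =>
            diagT (fun i => (hDeg E i : ℝ)) t + adjT r E t) =
          2 * ((1 / (n : ℝ)) * ∑ i, (hDeg E i : ℝ) ^ ((r : ℝ) / ((r : ℝ) - 1)))
              ^ (((r : ℝ) - 1) / (r : ℝ)) ↔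
        ∃ d : ℕ, ∀ i, hDeg E i = d) := by
  have : Nonempty (Fin n) := ⟨⟨0, hn⟩⟩
  have hr0 : 0 < r := by omega
  have hr1 : 1 < r := by omega
  obtain ⟨x, hx0, hx1, hρ, hmax⟩ := exists_maximizer hr0 hE
  rw [hρ]
  by_cases hreg : ∃ d : ℕ, ∀ i, hDeg E i = d
  · obtain ⟨d, hd⟩ := hreg
    have hle := signlessForm_le_of_hDeg_eq hr0 hE hd hx0
    rw [hx1, mul_one] at hle
    have hpm := powerMean_const (V := Fin n) hr1 d
    rw [Fintype.card_fin] at hpm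
    have heq : signlessForm r E x =
        2 * ((1 / (n : ℝ)) * ∑ i, (hDeg E i : ℝ) ^ ((r : ℝ) / ((r : ℝ) - 1)))
          ^ (((r : ℝ) - 1) / (r : ℝ)) := by
      simp_rw [hd]
      rw [hpm]
      exact hle.antisymm (le_of_hDeg_eq hE hd hmax)
    exact ⟨heq.ge, fun _ => ⟨d, hd⟩, fun _ => heq⟩
  · have hlt := powerMean_lt_of_not_regular hr1 hE hc hreg
      (maximizer_pos hr0 hE hc hx0 hx1 rfl hmax) (maximizer_eigen hr0 hx0 hx1 rfl hmax)
    rw [Fintype.card_fin] at hlt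
    exact ⟨hlt.le, fun h => absurd h hlt.ne', fun h => absurd h hreg⟩
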